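/- arXiv:2407.13080 — 5 statements merged into one kernel-verified Lean document; each statement's English description precedes it below -/
import Mathlib

section
/- Let L be a positive even integer and let M be the free staggered fermion matrix on the periodic lattice (ℤ/Lℤ)⁴, i.e., the real matrix with entries M_{mn} = (K/2) Σ_{μ=1}^{4} η_μ(m) (δ_{n, m+ê_μ} − δ_{n, m−ê_μ}) + m₀ δ_{nm} for real parameters K, m₀. Then the matrix W = MᵀM has entries W_{ac} = (m₀² + 2K²) δ_{ac} − (K²/4) Σ_{μ=1}^{4} (δ_{a+2ê_μ, c} + δ_{a−2ê_μ, c}); in particular W only connects lattice sites that are equal or next-to-nearest neighbors two hops apart in a single direction. -/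
open Matrix

/-- The staggered phase `η_μ(n) = (-1)^{Σ_{ν<μ} n̄_ν}` on the periodic lattice `(ℤ/Lℤ)⁴`,
using canonical representatives `n̄_ν ∈ {0,…,L-1}`. -/
noncomputable def etaP (L : ℕ) (μ : Fin 4) (n : Fin 4 → ZMod L) : ℝ :=
  (-1 : ℝ) ^ (∑ ν ∈ Finset.univ.filter (fun ν => ν < μ), (n ν).val)

/-- The unit vector `ê_μ` in `(ℤ/Lℤ)⁴`. -/
def uv (L : ℕ) (μ : Fin 4) : Fin 4 → ZMod L := Pi.single μ 1

/-- The sign picked up by `η_μ` under a unit hop in direction `ν`. -/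
noncomputable def hopSign (μ ν : Fin 4) : ℝ := if ν < μ then -1 else 1

lemma hopSign_self (μ : Fin 4) : hopSign μ μ = 1 := by
  simp [hopSign]

lemma hopSign_swap {μ ν : Fin 4} (h : μ ≠ ν) : hopSign ν μ = -hopSign μ ν := by
  rcases lt_or_gt_of_ne h with h | h <;> simp [hopSign, h, h.not_gt]

lemma neg_one_pow_val_add {L : ℕ} [NeZero L] (hL : Even L) (x y : ZMod L) :
    (-1 : ℝ) ^ (x + y).val = (-1) ^ x.val * (-1) ^ y.val := by
  rw [← pow_add, ZMod.val_add, neg_one_pow_eq_pow_mod_two,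
    Nat.mod_mod_of_dvd _ hL.two_dvd, ← neg_one_pow_eq_pow_mod_two]

lemma neg_one_pow_val_one {L : ℕ} [NeZero L] (hL : Even L) :
    (-1 : ℝ) ^ (1 : ZMod L).val = -1 := by
  have h : 1 < L := by
    have := NeZero.ne L
    rcases hL with ⟨k, rfl⟩
    lia
  rw [ZMod.val_one'' (by lia), pow_one]

lemma etaP_eq_prod (L : ℕ) (μ : Fin 4) (n : Fin 4 → ZMod L) :
    etaP L μ n = ∏ ν ∈ Finset.univ.filter (fun ν => ν < μ), (-1 : ℝ) ^ (n ν).val := by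
  rw [etaP, Finset.prod_pow_eq_pow_sum]

lemma etaP_mul_self (L : ℕ) (μ : Fin 4) (n : Fin 4 → ZMod L) :
    etaP L μ n * etaP L μ n = 1 := by
  rw [etaP, ← mul_pow]
  simp

lemma etaP_add_uv {L : ℕ} [NeZero L] (hL : Even L) (μ ν : Fin 4) (n : Fin 4 → ZMod L) :
    etaP L μ (n + uv L ν) = hopSign μ ν * etaP L μ n := by
  simp only [etaP_eq_prod, Pi.add_apply, neg_one_pow_val_add hL, Finset.prod_mul_distrib]
  rw [mul_comm]
  congr 1
  have h (ρ : Fin 4) : (-1 : ℝ) ^ (uv L ν ρ).val = if ρ = ν then -1 else 1 := by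
    by_cases hρ : ρ = ν
    · subst hρ
      simp [uv, neg_one_pow_val_one hL]
    · simp [uv, hρ]
  simp [h, hopSign, Finset.prod_ite_eq']

lemma etaP_sub_uv {L : ℕ} [NeZero L] (hL : Even L) (μ ν : Fin 4) (n : Fin 4 → ZMod L) :
    etaP L μ (n - uv L ν) = hopSign μ ν * etaP L μ n := by
  have h := etaP_add_uv hL μ ν (n - uv L ν)
  rw [sub_add_cancel] at h
  rw [h, ← mul_assoc]
  unfold hopSign
  split_ifs <;> simp

/-- The central difference in direction `μ`, weighted by the staggered phase. -/
noncomputable def staggeredDiff (L : ℕ) (μ : Fin 4) :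
    Matrix (Fin 4 → ZMod L) (Fin 4 → ZMod L) ℝ :=
  fun m n => etaP L μ m *
    ((if n = m + uv L μ then (1 : ℝ) else 0) - (if n = m - uv L μ then (1 : ℝ) else 0))

lemma staggeredDiff_transpose {L : ℕ} [NeZero L] (hL : Even L) (μ : Fin 4) :
    (staggeredDiff L μ)ᵀ = -staggeredDiff L μ := by
  ext m n
  simp only [transpose_apply, Matrix.neg_apply, staggeredDiff]
  have h₁ : m = n + uv L μ ↔ n = m - uv L μ := by rw [eq_comm, eq_sub_iff_add_eq]
  have h₂ : m = n - uv L μ ↔ n = m + uv L μ := by rw [eq_sub_iff_add_eq, eq_comm]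
  simp only [h₁, h₂]
  split_ifs with h h' h'
  · ring
  · rw [h, etaP_sub_uv hL, hopSign_self]
    ring
  · rw [h', etaP_add_uv hL, hopSign_self]
    ring
  · ring

lemma staggeredDiff_mul_apply {L : ℕ} [NeZero L] (hL : Even L) (μ ν : Fin 4)
    (a c : Fin 4 → ZMod L) :
    (staggeredDiff L μ * staggeredDiff L ν) a c =
      hopSign ν μ * (etaP L μ a * etaP L ν a) *
        ((if c = a + uv L μ + uv L ν then (1 : ℝ) else 0)
          - (if c = a + uv L μ - uv L ν then (1 : ℝ) else 0)
          - (if c = a - uv L μ + uv L ν then (1 : ℝ) else 0)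
          + (if c = a - uv L μ - uv L ν then (1 : ℝ) else 0)) := by
  simp only [Matrix.mul_apply, staggeredDiff, mul_assoc, ← Finset.mul_sum, sub_mul,
    Finset.sum_sub_distrib, ite_mul, one_mul, zero_mul, Finset.sum_ite_eq',
    Finset.mem_univ, if_true, etaP_add_uv hL, etaP_sub_uv hL]
  ring

lemma staggeredDiff_anticomm {L : ℕ} [NeZero L] (hL : Even L) {μ ν : Fin 4} (h : μ ≠ ν) :
    staggeredDiff L μ * staggeredDiff L ν + staggeredDiff L ν * staggeredDiff L μ = 0 := by
  ext a c
  rw [Matrix.add_apply, staggeredDiff_mul_apply hL, staggeredDiff_mul_apply hL, hopSign_swap h,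
    add_right_comm a (uv L ν) (uv L μ), add_sub_right_comm a (uv L ν) (uv L μ),
    sub_add_eq_add_sub a (uv L ν) (uv L μ), sub_right_comm a (uv L ν) (uv L μ), Matrix.zero_apply]
  ring

lemma staggeredDiff_mul_self_apply {L : ℕ} [NeZero L] (hL : Even L) (μ : Fin 4)
    (a c : Fin 4 → ZMod L) :
    (staggeredDiff L μ * staggeredDiff L μ) a c =
      (if a + 2 • uv L μ = c then (1 : ℝ) else 0) + (if a - 2 • uv L μ = c then (1 : ℝ) else 0)
        - 2 * (if a = c then (1 : ℝ) else 0) := by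
  rw [staggeredDiff_mul_apply hL, hopSign_self, etaP_mul_self, add_sub_cancel_right,
    sub_add_cancel, add_assoc a, sub_sub a, ← two_nsmul]
  simp only [eq_comm (a := c)]
  ring

lemma sum_mul_sum_of_anticomm {ι R : Type*} [Fintype ι] [Ring R] [IsAddTorsionFree R]
    (f : ι → R) (h : ∀ i j, i ≠ j → f i * f j + f j * f i = 0) :
    (∑ i, f i) * ∑ i, f i = ∑ i, f i * f i := by
  have hdouble : 2 • ((∑ i, f i) * ∑ i, f i) = 2 • ∑ i, f i * f i := by
    have hswap : ∑ i, ∑ j, f i * f j = ∑ i, ∑ j, f j * f i := Finset.sum_comm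
    rw [Finset.sum_mul_sum, two_nsmul]
    nth_rw 2 [hswap]
    rw [← Finset.sum_add_distrib, Finset.smul_sum]
    refine Finset.sum_congr rfl fun i _ => ?_
    rw [← Finset.sum_add_distrib, Finset.sum_eq_single i (fun j _ hj => h i j hj.symm) (by simp),
      two_nsmul]
  exact nsmul_right_injective two_ne_zero hdouble

/-- For the free staggered fermion matrix `M` on the periodic lattice `(ℤ/Lℤ)⁴` (`L` even),
the matrix `W = Mᵀ M` only connects equal sites and next-to-nearest neighbors two hops
apart in a single direction:
`W_{ac} = (m₀² + 2K²) δ_{ac} - (K²/4) Σ_μ (δ_{a+2ê_μ,c} + δ_{a-2ê_μ,c})`. -/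
theorem free_staggered_W (L : ℕ) [NeZero L] (hL : Even L) (K m0 : ℝ)
    (M : Matrix (Fin 4 → ZMod L) (Fin 4 → ZMod L) ℝ)
    (hM : ∀ m n, M m n =
      (K / 2) * ∑ μ, etaP L μ m *
        ((if n = m + uv L μ then (1 : ℝ) else 0) - (if n = m - uv L μ then (1 : ℝ) else 0))
      + m0 * (if n = m then (1 : ℝ) else 0)) :
    ∀ a c, (Mᵀ * M) a c =
      (m0 ^ 2 + 2 * K ^ 2) * (if a = c then (1 : ℝ) else 0)
      - (K ^ 2 / 4) * ∑ μ, ((if a + 2 • uv L μ = c then (1 : ℝ) else 0)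
        + (if a - 2 • uv L μ = c then (1 : ℝ) else 0)) := by
  have : IsAddTorsionFree (Matrix (Fin 4 → ZMod L) (Fin 4 → ZMod L) ℝ) :=
    inferInstanceAs (IsAddTorsionFree ((Fin 4 → ZMod L) → (Fin 4 → ZMod L) → ℝ))
  have hM' : M = (K / 2) • ∑ μ, staggeredDiff L μ + m0 • 1 := by
    ext m n
    simp [hM, staggeredDiff, Matrix.sum_apply, Matrix.one_apply, eq_comm (a := n) (b := m)]
  have hW : Mᵀ * M =
      (m0 ^ 2) • 1 - (K ^ 2 / 4) • ∑ μ, staggeredDiff L μ * staggeredDiff L μ := by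
    rw [← sum_mul_sum_of_anticomm _ fun _ _ => staggeredDiff_anticomm hL, hM']
    simp only [transpose_add, transpose_smul, transpose_sum, transpose_one,
      staggeredDiff_transpose hL, Finset.sum_neg_distrib]
    simp only [add_mul, mul_add, smul_mul_assoc, mul_smul_comm, one_mul, mul_one, neg_mul]
    module
  intro a c
  rw [hW]
  simp only [Matrix.sub_apply, Matrix.smul_apply, Matrix.sum_apply, Matrix.one_apply,
    staggeredDiff_mul_self_apply hL, Finset.sum_sub_distrib, Finset.sum_const, Finset.card_univ,
    Fintype.card_fin, smul_eq_mul, nsmul_eq_mul]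
  push_cast
  ring
end

section
/- Let D be a square complex matrix that is skew-Hermitian (Dᴴ = −D) and similar to its negative (there exists an invertible matrix S with S D S⁻¹ = −D), and let m₀ be a real number with m₀ > 0. Then det(m₀·1 + D) is a strictly positive real number: its imaginary part is zero and its real part is positive. -/
open Matrix

open scoped ComplexOrder in
/-- A positive real shift of a skew-Hermitian matrix is nonsingular. -/
theorem det_smul_one_add_ne_zero_of_skewHermitian {ι : Type*} [Fintype ι] [DecidableEq ι]
    {D : Matrix ι ι ℂ} (hskew : Dᴴ = -D) {m : ℝ} (hm : 0 < m) :
    ((m : ℂ) • (1 : Matrix ι ι ℂ) + D).det ≠ 0 := by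
  have hpos : (((m : ℂ) ^ 2) • (1 : Matrix ι ι ℂ) + Dᴴ * D).PosDef := by
    refine PosDef.add_posSemidef (PosDef.one.smul ?_) (posSemidef_conjTranspose_mul_self D)
    exact_mod_cast pow_pos hm 2
  have hfactor : ((m : ℂ) ^ 2) • (1 : Matrix ι ι ℂ) + Dᴴ * D =
      ((m : ℂ) • (1 : Matrix ι ι ℂ) - D) * ((m : ℂ) • (1 : Matrix ι ι ℂ) + D) := by
    rw [hskew]
    simp only [sub_mul, mul_add, smul_mul_assoc, mul_smul_comm, one_mul, mul_one, smul_sub,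
      smul_smul, neg_mul, pow_two]
    abel
  have hdet := hpos.det_pos.ne'
  rw [hfactor, det_mul] at hdet
  exact right_ne_zero_of_mul hdet

/-- A real shift of a skew-Hermitian matrix that is similar to its negative has real
determinant. -/
theorem det_smul_one_add_im_eq_zero {ι : Type*} [Fintype ι] [DecidableEq ι]
    {D S : Matrix ι ι ℂ} (hskew : Dᴴ = -D) (hS : IsUnit S) (hsim : S * D * S⁻¹ = -D) (m : ℝ) :
    ((m : ℂ) • (1 : Matrix ι ι ℂ) + D).det.im = 0 := by
  have hSS : S * S⁻¹ = 1 := mul_nonsing_inv S ((isUnit_iff_isUnit_det S).1 hS)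
  have hconj : S * ((m : ℂ) • (1 : Matrix ι ι ℂ) + D) * S⁻¹ =
      ((m : ℂ) • (1 : Matrix ι ι ℂ) + D)ᴴ := by
    simp [mul_add, add_mul, hsim, hskew, hSS]
  have hdet := congrArg det hconj
  rw [det_mul_right_comm, hSS, one_mul, det_conjTranspose] at hdet
  exact Complex.conj_eq_iff_im.1 hdet.symm

/-- If `D` is skew-Hermitian and similar to `-D` and `m₀ > 0`, then `det(m₀·1 + D)`
is a strictly positive real number. -/
theorem det_pos_real {n : ℕ} (D S : Matrix (Fin n) (Fin n) ℂ)
    (hskew : Dᴴ = -D) (hS : IsUnit S) (hsim : S * D * S⁻¹ = -D) (m0 : ℝ) (hm0 : 0 < m0) :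
    (Matrix.det ((m0 : ℂ) • (1 : Matrix (Fin n) (Fin n) ℂ) + D)).im = 0 ∧
    0 < (Matrix.det ((m0 : ℂ) • (1 : Matrix (Fin n) (Fin n) ℂ) + D)).re := by
  refine ⟨det_smul_one_add_im_eq_zero hskew hS hsim m0, ?_⟩
  let g : ℝ → ℝ := fun t =>
    ((m0 : ℂ) • (1 : Matrix (Fin n) (Fin n) ℂ) + (t : ℂ) • D).det.re
  have hcont : Continuous g := by fun_prop
  have hne (t : ℝ) : g t ≠ 0 := by
    have hskew_t : ((t : ℂ) • D)ᴴ = -((t : ℂ) • D) := by simp [hskew]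
    have hsim_t : S * ((t : ℂ) • D) * S⁻¹ = -((t : ℂ) • D) := by simp [hsim]
    exact fun h => det_smul_one_add_ne_zero_of_skewHermitian hskew_t hm0
      (Complex.ext h (det_smul_one_add_im_eq_zero hskew_t hS hsim_t m0))
  have hzero : 0 < g 0 := by
    have : g 0 = m0 ^ n := by simp [g, -Complex.ofReal_pow]
    rw [this]
    exact pow_pos hm0 n
  have hone : 0 < g 1 := by
    by_contra! h
    obtain ⟨t, ht⟩ := mem_range_of_exists_le_of_exists_ge hcont ⟨1, h⟩ ⟨0, hzero.le⟩
    exact hne t ht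
  simpa [g] using hone
end

section
/- Let D be a square complex matrix that is skew-Hermitian (Dᴴ = −D) and similar to its negative (there exists an invertible matrix S with S D S⁻¹ = −D), let m₀ > 0 be real, and set M = m₀·1 + D and W = MᴴM. Then det W = (det M)², det M equals the (positive real) square root of det W, and log(det W) = 2·log(det M), where det M and det W are identified with their (positive) real parts. -/
open Matrix

section SkewHermitian

variable {n : Type*} [DecidableEq n] {D S : Matrix n n ℂ}

theorem conjTranspose_smul_one_add_of_skew (hskew : Dᴴ = -D) (m : ℝ) :
    ((m : ℂ) • (1 : Matrix n n ℂ) + D)ᴴ = (m : ℂ) • (1 : Matrix n n ℂ) - D := by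
  rw [conjTranspose_add, conjTranspose_smul, hskew, conjTranspose_one, sub_eq_add_neg]
  simp

variable [Fintype n]

open scoped ComplexOrder in
theorem det_smul_one_add_ne_zero_of_skew (hskew : Dᴴ = -D) {m : ℝ} (hm : 0 < m) :
    ((m : ℂ) • (1 : Matrix n n ℂ) + D).det ≠ 0 := by
  have hgram : ((m : ℂ) • (1 : Matrix n n ℂ) + D)ᴴ * ((m : ℂ) • (1 : Matrix n n ℂ) + D) =
      ((m : ℂ) ^ 2) • (1 : Matrix n n ℂ) + Dᴴ * D := by
    rw [conjTranspose_smul_one_add_of_skew hskew, hskew]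
    simp only [sub_mul, mul_add, smul_mul_assoc, mul_smul_comm, one_mul, mul_one, smul_sub,
      smul_smul, pow_two, neg_mul]
    abel
  have hsq : (0 : ℂ) < (m : ℂ) ^ 2 := by exact_mod_cast pow_pos hm 2
  have hpos : (((m : ℂ) ^ 2) • (1 : Matrix n n ℂ) + Dᴴ * D).PosDef :=
    (PosDef.one.smul hsq).add_posSemidef (posSemidef_conjTranspose_mul_self D)
  have hdet := hpos.det_pos.ne'
  rw [← hgram, det_mul] at hdet
  exact right_ne_zero_of_mul hdet

theorem star_det_smul_one_add_of_skew_of_similar_neg (hskew : Dᴴ = -D) (hS : IsUnit S)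
    (hsim : S * D * S⁻¹ = -D) (m : ℝ) :
    star ((m : ℂ) • (1 : Matrix n n ℂ) + D).det = ((m : ℂ) • (1 : Matrix n n ℂ) + D).det := by
  have hinv : S * S⁻¹ = 1 := mul_nonsing_inv S ((isUnit_iff_isUnit_det S).mp hS)
  have hconj : (m : ℂ) • (1 : Matrix n n ℂ) - D =
      S * ((m : ℂ) • (1 : Matrix n n ℂ) + D) * S⁻¹ := by
    rw [mul_add, add_mul, hsim, mul_smul_comm, mul_one, smul_mul_assoc, hinv, sub_eq_add_neg]
  rw [← det_conjTranspose, conjTranspose_smul_one_add_of_skew hskew, hconj, det_mul_right_comm,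
    hinv, one_mul]

/-- The determinant stays real and nonzero along the segment `m • 1 + s • D`, `0 ≤ s ≤ 1`,
so it keeps the sign it has at `s = 0`. -/
theorem re_det_smul_one_add_pos_of_skew_of_similar_neg (hskew : Dᴴ = -D) (hS : IsUnit S)
    (hsim : S * D * S⁻¹ = -D) {m : ℝ} (hm : 0 < m) :
    0 < ((m : ℂ) • (1 : Matrix n n ℂ) + D).det.re := by
  by_contra! hle
  let g : ℝ → ℝ := fun s => ((m : ℂ) • (1 : Matrix n n ℂ) + (s : ℂ) • D).det.re
  have hg : Continuous g := by fun_prop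
  have hg0 : 0 ≤ g 0 := by
    have : g 0 = m ^ Fintype.card n := by
      simp only [g, Complex.ofReal_zero, zero_smul, add_zero, det_smul, det_one, mul_one]
      exact_mod_cast Complex.ofReal_re _
    rw [this]
    positivity
  have hg1 : g 1 ≤ 0 := by simpa [g] using hle
  obtain ⟨s, hs⟩ := mem_range_of_exists_le_of_exists_ge hg ⟨1, hg1⟩ ⟨0, hg0⟩
  have hskew' : ((s : ℂ) • D)ᴴ = -((s : ℂ) • D) := by
    rw [conjTranspose_smul, hskew, smul_neg]
    simp
  have hsim' : S * ((s : ℂ) • D) * S⁻¹ = -((s : ℂ) • D) := by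
    rw [mul_smul_comm, smul_mul_assoc, hsim, smul_neg]
  refine det_smul_one_add_ne_zero_of_skew hskew' hm (Complex.ext hs ?_)
  exact Complex.conj_eq_iff_im.mp
    (star_det_smul_one_add_of_skew_of_similar_neg hskew' hS hsim' m)

end SkewHermitian

/-- For `D` skew-Hermitian and similar to `-D`, `m₀ > 0`, `M = m₀·1 + D` and `W = Mᴴ M`:
`det W = (det M)²`, `det M` is the positive real square root of `det W`, and
`log det W = 2 log det M` (with `det M`, `det W` identified with their real parts). -/
theorem det_W_relations {n : ℕ} (D S : Matrix (Fin n) (Fin n) ℂ)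
    (hskew : Dᴴ = -D) (hS : IsUnit S) (hsim : S * D * S⁻¹ = -D) (m0 : ℝ) (hm0 : 0 < m0)
    (M W : Matrix (Fin n) (Fin n) ℂ)
    (hM : M = (m0 : ℂ) • (1 : Matrix (Fin n) (Fin n) ℂ) + D)
    (hW : W = Mᴴ * M) :
    W.det = M.det ^ 2 ∧
    M.det = ((Real.sqrt (W.det.re) : ℝ) : ℂ) ∧
    Real.log (W.det.re) = 2 * Real.log (M.det.re) := by
  have hstar : star M.det = M.det := by
    rw [hM]
    exact star_det_smul_one_add_of_skew_of_similar_neg hskew hS hsim m0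
  have hpos : 0 < M.det.re := by
    rw [hM]
    exact re_det_smul_one_add_pos_of_skew_of_similar_neg hskew hS hsim hm0
  have hdet : W.det = M.det ^ 2 := by
    rw [hW, det_mul, det_conjTranspose, hstar, pow_two]
  have hreal : ((M.det.re : ℝ) : ℂ) = M.det := Complex.conj_eq_iff_re.mp hstar
  have hre : W.det.re = M.det.re ^ 2 := by
    rw [hdet, ← hreal, ← Complex.ofReal_pow, Complex.ofReal_re, Complex.ofReal_re]
  refine ⟨hdet, ?_, ?_⟩
  · rw [hre, Real.sqrt_sq hpos.le, hreal]
  · rw [hre, Real.log_pow, Nat.cast_ofNat]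
end

section
/- Let A be an n×n Hermitian complex matrix such that 1 − A² is positive semidefinite, and let S denote the positive semidefinite square root of 1 − A². Then the 2n×2n block matrix B = [[A, S], [−S, A]] is unitary: BᴴB = 1 and BBᴴ = 1. In particular, the top-left n×n block of the unitary B equals A, so B is a block-encoding of A. -/
open Matrix ComplexOrder

open scoped MatrixOrder Matrix.Norms.L2Operator in
/-- A matrix commuting with the square of a positive semidefinite matrix commutes with the
matrix itself. -/
theorem Matrix.PosSemidef.commute_of_commute_mul_self {m : Type*} [Fintype m] [DecidableEq m]
    {S A : Matrix m m ℂ} (hS : S.PosSemidef) (h : Commute (S * S) A) : Commute S A := by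
  have hroot : CFC.sqrt (S * S) = S := CFC.sqrt_unique rfl hS.nonneg
  rw [← hroot]
  exact h.cfcₙ_nnreal _

/-- For a Hermitian `A` with `1 - A²` positive semidefinite and `S` the positive
semidefinite square root of `1 - A²`, the block matrix `B = [[A, S], [-S, A]]` is
unitary, and its top-left block is `A` (so `B` is a block-encoding of `A`). -/
theorem block_encoding_unitary {n : ℕ} (A S : Matrix (Fin n) (Fin n) ℂ)
    (hA : A.IsHermitian)
    (hpsd : ((1 : Matrix (Fin n) (Fin n) ℂ) - A * A).PosSemidef)
    (hS : S.PosSemidef) (hS2 : S * S = 1 - A * A) :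
    (Matrix.fromBlocks A S (-S) A)ᴴ * Matrix.fromBlocks A S (-S) A = 1 ∧
    Matrix.fromBlocks A S (-S) A * (Matrix.fromBlocks A S (-S) A)ᴴ = 1 ∧
    (∀ i j, Matrix.fromBlocks A S (-S) A (Sum.inl i) (Sum.inl j) = A i j) := by
  have hcomm : S * A = A * S := by
    refine (hS.commute_of_commute_mul_self ?_).eq
    rw [hS2]
    exact (Commute.one_left A).sub_left ((Commute.refl A).mul_left (Commute.refl A))
  refine ⟨?_, ?_, fun _ _ => rfl⟩ <;>
    simp [fromBlocks_conjTranspose, fromBlocks_multiply, hA.eq, hS.isHermitian.eq, hS2, hcomm,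
      ← fromBlocks_one]
end

section
/- Let 𝒰₁, 𝒰₂, 𝒰₃, 𝒰₄ be n×n unitary complex matrices, let m' be a real number, set M = 2m'·1 + Σ_{μ=1}^{4} (𝒰_μ − 𝒰_μᴴ) and W = MᴴM. Then W is Hermitian positive semidefinite and every eigenvalue λ of W is a real number satisfying 4m'² ≤ λ ≤ 4m'² + 64; in particular, if m' ≠ 0 then W is positive definite with condition number λ_max/λ_min at most (16 + m'²)/m'². -/
open Matrix ComplexOrder

open scoped Matrix.Norms.L2Operator in
/-- A sum of `U - Uᴴ` over a finite family of unitary matrices has operator norm at most twice the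
size of the family. -/
lemma norm_sum_sub_conjTranspose_le {ι n : Type*} [Fintype ι] [Fintype n] [DecidableEq n]
    [Nonempty n] (U : ι → Matrix n n ℂ) (h : ∀ i, (U i)ᴴ * U i = 1) :
    ‖∑ i, (U i - (U i)ᴴ)‖ ≤ 2 * Fintype.card ι := by
  have norm_U (i : ι) : ‖U i‖ = 1 :=
    CStarRing.norm_of_mem_unitary (Matrix.mem_unitaryGroup_iff'.mpr (h i))
  have norm_le (i : ι) : ‖U i - (U i)ᴴ‖ ≤ 2 :=
    calc ‖U i - (U i)ᴴ‖ ≤ ‖U i‖ + ‖(U i)ᴴ‖ := norm_sub_le _ _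
      _ = 2 := by rw [Matrix.l2_opNorm_conjTranspose, norm_U]; norm_num
  calc ‖∑ i, (U i - (U i)ᴴ)‖ ≤ ∑ _i : ι, (2 : ℝ) := norm_sum_le_of_le _ fun i _ => norm_le i
    _ = 2 * Fintype.card ι := by simp [mul_comm]

/-- For skew-Hermitian `D` and real `c`, the cross terms of `(c + D)ᴴ (c + D)` cancel. -/
lemma conjTranspose_mul_self_real_smul_one_add {n : Type*} [Fintype n] [DecidableEq n]
    {D : Matrix n n ℂ} (hD : Dᴴ = -D) (c : ℝ) :
    ((c : ℂ) • (1 : Matrix n n ℂ) + D)ᴴ * ((c : ℂ) • (1 : Matrix n n ℂ) + D) =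
      ((c ^ 2 : ℝ) : ℂ) • (1 : Matrix n n ℂ) + Dᴴ * D := by
  simp [hD, add_mul, mul_add, smul_smul, sq, -Complex.coe_smul]

open scoped Matrix.Norms.L2Operator in
/-- Elements of the spectrum of `c + DᴴD` are real and lie between `c` and `c + ‖D‖ ^ 2`. -/
lemma mem_spectrum_real_smul_one_add {n : Type*} [Fintype n] [DecidableEq n] [Nonempty n]
    (D : Matrix n n ℂ) (c : ℝ) {z : ℂ}
    (hz : z ∈ spectrum ℂ ((c : ℂ) • (1 : Matrix n n ℂ) + Dᴴ * D)) :
    z.im = 0 ∧ c ≤ z.re ∧ z.re ≤ c + ‖D‖ ^ 2 := by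
  have mem : z - c ∈ spectrum ℂ (Dᴴ * D) := by
    rw [← Algebra.algebraMap_eq_smul_one, ← spectrum.singleton_add_eq] at hz
    obtain ⟨_, rfl, w, hw, rfl⟩ := hz
    simpa using hw
  have nonneg : 0 ≤ z - c :=
    (Matrix.posSemidef_iff_isHermitian_and_spectrum_nonneg.mp
      (Matrix.posSemidef_conjTranspose_mul_self D)).2 mem
  have norm_le : ‖z - c‖ ≤ ‖D‖ ^ 2 := by
    rw [sq, ← Matrix.l2_opNorm_conjTranspose_mul_self]
    exact spectrum.norm_le_norm_of_mem mem
  have re_le := (Complex.re_le_norm _).trans norm_le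
  rw [Complex.le_def] at nonneg
  simp only [Complex.zero_re, Complex.sub_re, Complex.ofReal_re, Complex.zero_im, Complex.sub_im,
    Complex.ofReal_im] at nonneg re_le
  exact ⟨by linarith [nonneg.2], by linarith [nonneg.1], by linarith⟩

/-- For `M = 2m'·1 + Σ_{μ=1}^4 (𝒰_μ - 𝒰_μᴴ)` with `𝒰_μ` unitary and `m'` real,
the matrix `W = Mᴴ M` is Hermitian positive semidefinite, every eigenvalue `λ` of `W`
is real with `4m'² ≤ λ ≤ 4m'² + 64`, and if `m' ≠ 0` then `W` is positive definite
with condition number at most `(16 + m'²)/m'²`. -/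
theorem spectral_bound_W {n : ℕ} (𝒰 : Fin 4 → Matrix (Fin n) (Fin n) ℂ)
    (h : ∀ μ, (𝒰 μ)ᴴ * 𝒰 μ = 1) (m' : ℝ)
    (M W : Matrix (Fin n) (Fin n) ℂ)
    (hM : M = (2 * m' : ℂ) • (1 : Matrix (Fin n) (Fin n) ℂ) + ∑ μ, (𝒰 μ - (𝒰 μ)ᴴ))
    (hW : W = Mᴴ * M) :
    W.PosSemidef ∧
    (∀ lam ∈ spectrum ℂ W,
      lam.im = 0 ∧ 4 * m' ^ 2 ≤ lam.re ∧ lam.re ≤ 4 * m' ^ 2 + 64) ∧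
    (m' ≠ 0 → W.PosDef ∧
      ∀ lam₁ ∈ spectrum ℂ W, ∀ lam₂ ∈ spectrum ℂ W,
        lam₁.re / lam₂.re ≤ (16 + m' ^ 2) / m' ^ 2) := by
  set D := ∑ μ, (𝒰 μ - (𝒰 μ)ᴴ) with hD
  have skew : Dᴴ = -D := by
    simp [hD, Matrix.conjTranspose_sum]
  have decomp : W = ((4 * m' ^ 2 : ℝ) : ℂ) • (1 : Matrix (Fin n) (Fin n) ℂ) + Dᴴ * D := by
    have key := conjTranspose_mul_self_real_smul_one_add skew (2 * m')
    rw [mul_pow] at key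
    norm_num at key ⊢
    rw [hW, hM, ← key]
    simp
  have bounds : ∀ lam ∈ spectrum ℂ W,
      lam.im = 0 ∧ 4 * m' ^ 2 ≤ lam.re ∧ lam.re ≤ 4 * m' ^ 2 + 64 := by
    intro lam hlam
    rcases isEmpty_or_nonempty (Fin n) with _ | _
    · simp [spectrum.of_subsingleton] at hlam
    · obtain ⟨him, hlow, hup⟩ := mem_spectrum_real_smul_one_add D _ (decomp ▸ hlam)
      have norm_D := norm_sum_sub_conjTranspose_le 𝒰 h
      rw [← hD, Fintype.card_fin] at norm_D
      open scoped Matrix.Norms.L2Operator in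
      have norm_sq := pow_le_pow_left₀ (norm_nonneg _) norm_D 2
      norm_num at norm_sq
      exact ⟨him, hlow, hup.trans (by linarith)⟩
  refine ⟨hW ▸ Matrix.posSemidef_conjTranspose_mul_self M, bounds, fun hm => ⟨?_, ?_⟩⟩
  · have pos : (0 : ℂ) < ((4 * m' ^ 2 : ℝ) : ℂ) := by
      rw [Complex.zero_lt_real]
      positivity
    rw [decomp]
    exact (Matrix.PosDef.one.smul pos).add_posSemidef (Matrix.posSemidef_conjTranspose_mul_self D)
  · intro lam₁ h₁ lam₂ h₂
    have pos : 0 < 4 * m' ^ 2 := by positivity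
    calc lam₁.re / lam₂.re ≤ (4 * m' ^ 2 + 64) / (4 * m' ^ 2) :=
          div_le_div₀ (by positivity) (bounds _ h₁).2.2 pos (bounds _ h₂).2.1
      _ = (16 + m' ^ 2) / m' ^ 2 := by
          field_simp
          ring
end
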